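/- Let u, v : ℝ³ ∖ {0} → ℝ be smooth and homogeneous of degree 0. Then for every k ∈ {1,2,3}, ∫_{S²} x_k · tr( J_x H_u(x) H_v(x) ) dS = − ∫_{S²} x_k ⟨x, ∇u(x) × ∇(Δv + 2v)(x)⟩ dS. (This realizes the integration-by-parts formula ∫_{S²} X̃^k ε^{AB}∇_A∇_D u ∇_B∇^D v = −∫_{S²} X̃^k ε^{AB}∇_A u ∇_B(Δ_{S²}+2)v on the round sphere.) -/

import Mathlib

open MeasureTheory Matrix

noncomputable section

/-- Euclidean 3-space. -/
abbrev E3 := EuclideanSpace ℝ (Fin 3)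

/-- The Euclidean inner product on coordinate vectors. -/
def dot3 (a b : Fin 3 → ℝ) : ℝ := ∑ i, a i * b i

/-- The cross product in ℝ³. -/
def cross3 (a b : Fin 3 → ℝ) : Fin 3 → ℝ :=
  ![a 1 * b 2 - a 2 * b 1, a 2 * b 0 - a 0 * b 2, a 0 * b 1 - a 1 * b 0]

/-- Standard basis vectors of E3. -/
def e3 (i : Fin 3) : E3 := EuclideanSpace.single i 1

/-- The ambient gradient of `u : ℝ³ → ℝ` (as a coordinate vector). -/
def grad3 (u : E3 → ℝ) (x : E3) : Fin 3 → ℝ := fun i => fderiv ℝ u x (e3 i)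

/-- The ambient Hessian matrix of `u : ℝ³ → ℝ`. -/
def hess3 (u : E3 → ℝ) (x : E3) : Matrix (Fin 3) (Fin 3) ℝ :=
  Matrix.of fun i j => iteratedFDeriv ℝ 2 u x ![e3 i, e3 j]

/-- The ambient Euclidean Laplacian Δu = Σᵢ ∂²u/∂xᵢ². -/
def lap3 (u : E3 → ℝ) : E3 → ℝ := fun x => ∑ i, hess3 u x i i

/-- The orthogonal projection P(x) = I - x xᵀ onto the tangent plane of S² at x. -/
def proj3 (x : E3) : Matrix (Fin 3) (Fin 3) ℝ := 1 - Matrix.of fun i j => x i * x j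

/-- The projected ambient Hessian H_u(x) = P(x) (D²u)(x) P(x), realizing the intrinsic
Hessian on S² of the restriction of a degree-0 homogeneous function. -/
def hessS (u : E3 → ℝ) (x : E3) : Matrix (Fin 3) (Fin 3) ℝ := proj3 x * hess3 u x * proj3 x

/-- The matrix of the linear map `w ↦ x × w` on ℝ³. -/
def crossMat (x : E3) : Matrix (Fin 3) (Fin 3) ℝ :=
  !![0, -x 2, x 1; x 2, 0, -x 0; -x 1, x 0, 0]

/-- `u` is (positively) homogeneous of degree 0 away from the origin. -/
def Homog0 (u : E3 → ℝ) : Prop := ∀ c : ℝ, 0 < c → ∀ x : E3, x ≠ 0 → u (c • x) = u x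

open scoped ContDiff

/-- The unit sphere has finite area. -/
theorem hausdorffMeasure_sphere_lt_top : μH[2] (Metric.sphere (0 : E3) 1) < ⊤ := by
  let g : ℝ × ℝ → E3 := fun p =>
    !₂[Real.cos p.1 * Real.cos p.2, Real.cos p.1 * Real.sin p.2, Real.sin p.1]
  have hg : ContDiff ℝ 1 g := by
    rw [contDiff_euclidean]
    intro i
    fin_cases i <;> simp [g] <;> fun_prop
  let K : Set (ℝ × ℝ) := Set.Icc (-4) 4 ×ˢ Set.Icc (-4) 4
  have hK : IsCompact K := isCompact_Icc.prod isCompact_Icc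
  obtain ⟨C, hC⟩ := LocallyLipschitzOn.exists_lipschitzOnWith_of_compact hK
    (hg.locallyLipschitz.locallyLipschitzOn (s := K))
  have hsub : Metric.sphere (0 : E3) 1 ⊆ g '' K := by
    intro x hx
    have hx1 : x 0 ^ 2 + x 1 ^ 2 + x 2 ^ 2 = 1 := by
      have h := EuclideanSpace.real_norm_sq_eq x
      rw [mem_sphere_zero_iff_norm.1 hx, Fin.sum_univ_three] at h
      linarith
    let z : ℂ := ⟨x 0, x 1⟩
    have hz : ‖z‖ ^ 2 = x 0 ^ 2 + x 1 ^ 2 := by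
      rw [Complex.sq_norm, Complex.normSq_apply]; ring
    have hcos : Real.cos (Real.arcsin (x 2)) = ‖z‖ := by
      rw [Real.cos_arcsin, show 1 - x 2 ^ 2 = ‖z‖ ^ 2 by rw [hz]; linarith]
      exact Real.sqrt_sq (norm_nonneg _)
    have hpi := Real.pi_lt_four
    refine ⟨(Real.arcsin (x 2), Complex.arg z), ⟨⟨?_, ?_⟩, ⟨?_, ?_⟩⟩, ?_⟩
    · linarith [Real.neg_pi_div_two_le_arcsin (x 2)]
    · linarith [Real.arcsin_le_pi_div_two (x 2)]
    · linarith [Complex.neg_pi_lt_arg z]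
    · linarith [Complex.arg_le_pi z]
    · ext i
      fin_cases i
      · simp [g, hcos, Complex.norm_mul_cos_arg, z]
      · simp [g, hcos, Complex.norm_mul_sin_arg, z]
      · simp only [g]
        exact Real.sin_arcsin (by nlinarith) (by nlinarith)
  refine (measure_mono hsub).trans_lt ((hC.hausdorffMeasure_image_le zero_le_two).trans_lt ?_)
  rw [hausdorffMeasure_prod_real]
  exact ENNReal.mul_lt_top (by simp) hK.measure_lt_top

/-- The rotation by the angle `t` about the `i`-th coordinate axis. -/
def rot (i : Fin 3) (t : ℝ) (x : E3) : E3 :=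
  x + (Real.cos t - 1) • (x (i + 1) • e3 (i + 1) + x (i + 2) • e3 (i + 2)) +
    Real.sin t • (x (i + 1) • e3 (i + 2) - x (i + 2) • e3 (i + 1))

theorem norm_rot (i : Fin 3) (t : ℝ) (x : E3) : ‖rot i t x‖ = ‖x‖ := by
  have h := Real.sin_sq_add_cos_sq t
  rw [← sq_eq_sq₀ (norm_nonneg _) (norm_nonneg _), EuclideanSpace.real_norm_sq_eq,
    EuclideanSpace.real_norm_sq_eq, Fin.sum_univ_three, Fin.sum_univ_three]
  fin_cases i <;> simp [rot, e3]
  · linear_combination (x 1 ^ 2 + x 2 ^ 2) * h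
  · linear_combination (x 0 ^ 2 + x 2 ^ 2) * h
  · linear_combination (x 0 ^ 2 + x 1 ^ 2) * h

/-- The rotation about a coordinate axis as a linear isometry. -/
def rotIsometry (i : Fin 3) (t : ℝ) : E3 ≃ₗᵢ[ℝ] E3 :=
  LinearIsometry.toLinearIsometryEquiv
    { toFun := rot i t
      map_add' := fun x y => by ext j; simp [rot]; ring
      map_smul' := fun c x => by ext j; simp [rot]; ring
      norm_map' := norm_rot i t } rfl

theorem rot_zero (i : Fin 3) (x : E3) : rot i 0 x = x := by simp [rot]

theorem hasDerivAt_rot (i : Fin 3) (t : ℝ) (x : E3) :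
    HasDerivAt (fun s => rot i s x)
      (rot i t x (i + 1) • e3 (i + 2) - rot i t x (i + 2) • e3 (i + 1)) t := by
  have h := (((Real.hasDerivAt_cos t).sub_const 1).smul_const
    (x (i + 1) • e3 (i + 1) + x (i + 2) • e3 (i + 2))).const_add x |>.add
    ((Real.hasDerivAt_sin t).smul_const (x (i + 1) • e3 (i + 2) - x (i + 2) • e3 (i + 1)))
  refine h.congr_deriv ?_
  ext j
  fin_cases i <;> fin_cases j <;> simp [rot, e3] <;> ring

theorem integral_comp_rot (f : E3 → ℝ) (i : Fin 3) (t : ℝ) :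
    ∫ x in Metric.sphere (0 : E3) 1, f (rot i t x) ∂μH[2] =
      ∫ x in Metric.sphere (0 : E3) 1, f x ∂μH[2] := by
  let e := (rotIsometry i t).toIsometryEquiv
  have h := (e.measurePreserving_hausdorffMeasure 2).setIntegral_preimage_emb
    e.toHomeomorph.measurableEmbedding f (Metric.sphere (0 : E3) 1)
  have hs : e ⁻¹' Metric.sphere (0 : E3) 1 = Metric.sphere (0 : E3) 1 := by
    ext x
    simp only [Set.mem_preimage, mem_sphere_zero_iff_norm]
    exact Eq.congr_left (norm_rot i t x)
  rw [hs] at h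
  exact h

theorem sphere_subset_compl : Metric.sphere (0 : E3) 1 ⊆ {(0 : E3)}ᶜ := fun x hx h0 => by
  rw [Set.mem_singleton_iff.1 h0] at hx
  simp at hx

theorem integrableOn_sphere {f : E3 → ℝ} (hf : ContinuousOn f {(0 : E3)}ᶜ) :
    IntegrableOn f (Metric.sphere (0 : E3) 1) μH[2] :=
  (hf.mono sphere_subset_compl).integrableOn_of_subset_isCompact (isCompact_sphere _ _)
    (isCompact_sphere _ _).measurableSet subset_rfl hausdorffMeasure_sphere_lt_top.ne

theorem contDiffOn_grad3 {f : E3 → ℝ} (hf : ContDiffOn ℝ ∞ f {(0 : E3)}ᶜ) (i : Fin 3) :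
    ContDiffOn ℝ ∞ (fun x => grad3 f x i) {(0 : E3)}ᶜ :=
  (hf.fderiv_of_isOpen isOpen_compl_singleton (by simp)).clm_apply contDiffOn_const

theorem ContDiffOn.differentiableAt_of_ne {f : E3 → ℝ} (hf : ContDiffOn ℝ ∞ f {(0 : E3)}ᶜ)
    {x : E3} (hx : x ≠ 0) : DifferentiableAt ℝ f x :=
  (hf.contDiffAt (isOpen_compl_singleton.mem_nhds hx)).differentiableAt (by simp)

/-- The derivative along the rotations about the `i`-th coordinate axis. -/
def rotDeriv (i : Fin 3) (f : E3 → ℝ) (x : E3) : ℝ :=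
  x (i + 1) * grad3 f x (i + 2) - x (i + 2) * grad3 f x (i + 1)

theorem continuousOn_rotDeriv {f : E3 → ℝ} (hf : ContDiffOn ℝ ∞ f {(0 : E3)}ᶜ) (i : Fin 3) :
    ContinuousOn (rotDeriv i f) {(0 : E3)}ᶜ := by
  have h := fun j => (contDiffOn_grad3 hf j).continuousOn
  unfold rotDeriv
  fun_prop

theorem integral_rotDeriv {f : E3 → ℝ} (hf : ContDiffOn ℝ ∞ f {(0 : E3)}ᶜ) (i : Fin 3) :
    ∫ x in Metric.sphere (0 : E3) 1, rotDeriv i f x ∂μH[2] = 0 := by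
  have hmeas : MeasurableSet (Metric.sphere (0 : E3) 1) := (isCompact_sphere _ _).measurableSet
  have hrot : ∀ t, ∀ x ∈ Metric.sphere (0 : E3) 1, rot i t x ∈ Metric.sphere (0 : E3) 1 :=
    fun t x hx => by
      rw [mem_sphere_zero_iff_norm] at hx ⊢
      rw [norm_rot, hx]
  obtain ⟨C, hC⟩ := (isCompact_sphere (0 : E3) 1).exists_bound_of_continuousOn
    ((continuousOn_rotDeriv hf i).mono sphere_subset_compl)
  have key := hasDerivAt_integral_of_dominated_loc_of_deriv_le
    (μ := (μH[2] : Measure E3).restrict (Metric.sphere (0 : E3) 1))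
    (F := fun t x => f (rot i t x)) (F' := fun t x => rotDeriv i f (rot i t x))
    (x₀ := (0 : ℝ)) (s := Set.univ) (bound := fun _ => C) Filter.univ_mem
    (Filter.Eventually.of_forall fun t => ContinuousOn.aestronglyMeasurable
      (hf.continuousOn.comp (rotIsometry i t).continuous.continuousOn
        fun x hx => sphere_subset_compl (hrot t x hx)) hmeas)
    (by
      simp only [rot_zero]
      exact integrableOn_sphere hf.continuousOn)
    (by
      simp only [rot_zero]
      exact (integrableOn_sphere (continuousOn_rotDeriv hf i)).aestronglyMeasurable)
    ((ae_restrict_iff' hmeas).2 (Filter.Eventually.of_forall fun x hx t _ => hC _ (hrot t x hx)))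
    (integrableOn_const hausdorffMeasure_sphere_lt_top.ne)
    ((ae_restrict_iff' hmeas).2 (Filter.Eventually.of_forall fun x hx t _ => by
      have h := (hf.differentiableAt_of_ne
        (sphere_subset_compl (hrot t x hx))).hasFDerivAt.comp_hasDerivAt t (hasDerivAt_rot i t x)
      refine h.congr_deriv ?_
      simp [rotDeriv, grad3]))
  have h := key.2
  simp only [integral_comp_rot, rot_zero] at h
  exact h.unique (hasDerivAt_const _ _)

theorem hess3_apply {f : E3 → ℝ} (hf : ContDiffOn ℝ ∞ f {(0 : E3)}ᶜ) {x : E3} (hx : x ≠ 0)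
    (i j : Fin 3) : hess3 f x i j = grad3 (fun y => grad3 f y j) x i := by
  have h : DifferentiableAt ℝ (fderiv ℝ f) x :=
    ((hf.fderiv_of_isOpen isOpen_compl_singleton (m := ∞) (by simp)).contDiffAt
      (isOpen_compl_singleton.mem_nhds hx)).differentiableAt (by simp)
  simp only [hess3, grad3, Matrix.of_apply, iteratedFDeriv_two_apply]
  rw [fderiv_clm_apply h (differentiableAt_const _)]
  simp

theorem grad3_comm {f : E3 → ℝ} (hf : ContDiffOn ℝ ∞ f {(0 : E3)}ᶜ) {x : E3} (hx : x ≠ 0)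
    (i j : Fin 3) :
    grad3 (fun y => grad3 f y i) x j = grad3 (fun y => grad3 f y j) x i := by
  rw [← hess3_apply hf hx, ← hess3_apply hf hx]
  have h : IsSymmSndFDerivAt ℝ f x :=
    (hf.contDiffAt (isOpen_compl_singleton.mem_nhds hx)).isSymmSndFDerivAt
      (by simpa using ENat.LEInfty.out)
  simpa [hess3, iteratedFDeriv_two_apply] using h (e3 j) (e3 i)

theorem Filter.EventuallyEq.grad3_eq {f g : E3 → ℝ} {x : E3} (h : f =ᶠ[nhds x] g) (i : Fin 3) :
    grad3 f x i = grad3 g x i := by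
  rw [grad3, grad3, h.fderiv_eq]

theorem grad3_add {f g : E3 → ℝ} {x : E3} (hf : DifferentiableAt ℝ f x)
    (hg : DifferentiableAt ℝ g x) (i : Fin 3) :
    grad3 (fun y => f y + g y) x i = grad3 f x i + grad3 g x i := by
  simp [grad3, fderiv_fun_add hf hg]

theorem grad3_sub {f g : E3 → ℝ} {x : E3} (hf : DifferentiableAt ℝ f x)
    (hg : DifferentiableAt ℝ g x) (i : Fin 3) :
    grad3 (fun y => f y - g y) x i = grad3 f x i - grad3 g x i := by
  simp [grad3, fderiv_fun_sub hf hg]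

theorem grad3_mul {f g : E3 → ℝ} {x : E3} (hf : DifferentiableAt ℝ f x)
    (hg : DifferentiableAt ℝ g x) (i : Fin 3) :
    grad3 (fun y => f y * g y) x i = f x * grad3 g x i + grad3 f x i * g x := by
  simp [grad3, fderiv_fun_mul hf hg]; ring

theorem grad3_coord (x : E3) (i j : Fin 3) :
    grad3 (fun y => y j) x i = if j = i then 1 else 0 := by
  have h : HasFDerivAt (fun y : E3 => y j) (EuclideanSpace.proj (𝕜 := ℝ) j) x :=
    (EuclideanSpace.proj (𝕜 := ℝ) j).hasFDerivAt
  rw [grad3, h.fderiv]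
  simp [e3]

theorem differentiableAt_coord (x : E3) (j : Fin 3) : DifferentiableAt ℝ (fun y : E3 => y j) x :=
  (EuclideanSpace.proj (𝕜 := ℝ) j).differentiableAt

theorem sum_coord_mul_grad3 {f : E3 → ℝ} (hf : ContDiffOn ℝ ∞ f {(0 : E3)}ᶜ) (hf0 : Homog0 f)
    {x : E3} (hx : x ≠ 0) :
    x 0 * grad3 f x 0 + x 1 * grad3 f x 1 + x 2 * grad3 f x 2 = 0 := by
  have h1 : HasDerivAt (fun c : ℝ => c • x) x 1 := by
    simpa using (hasDerivAt_id (1 : ℝ)).smul_const x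
  have h2 : HasDerivAt (fun c : ℝ => f (c • x)) (fderiv ℝ f x x) 1 := by
    have h := (hf.differentiableAt_of_ne hx).hasFDerivAt
    rw [← one_smul ℝ x] at h
    have h' := h.comp_hasDerivAt (1 : ℝ) h1
    rw [one_smul] at h'
    exact h'
  have h3 : (fun c : ℝ => f (c • x)) =ᶠ[nhds 1] fun _ => f x := by
    filter_upwards [lt_mem_nhds one_pos] with c hc using hf0 c hc x hx
  have h4 : fderiv ℝ f x x = 0 := (h2.congr_of_eventuallyEq h3.symm).unique (hasDerivAt_const _ _)
  have h5 : x = x 0 • e3 0 + x 1 • e3 1 + x 2 • e3 2 := by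
    ext j
    fin_cases j <;> simp [e3]
  have h6 : fderiv ℝ f x (x 0 • e3 0 + x 1 • e3 1 + x 2 • e3 2) = 0 := by rw [← h5, h4]
  simpa [grad3] using h6

theorem sum_coord_mul_grad3_grad3 {f : E3 → ℝ} (hf : ContDiffOn ℝ ∞ f {(0 : E3)}ᶜ)
    (hf0 : Homog0 f) {x : E3} (hx : x ≠ 0) (i : Fin 3) :
    x 0 * grad3 (fun y => grad3 f y 0) x i + x 1 * grad3 (fun y => grad3 f y 1) x i +
      x 2 * grad3 (fun y => grad3 f y 2) x i = - grad3 f x i := by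
  have hev : (fun y : E3 => y 0 * grad3 f y 0 + y 1 * grad3 f y 1 + y 2 * grad3 f y 2)
      =ᶠ[nhds x] fun _ => 0 := by
    filter_upwards [isOpen_compl_singleton.mem_nhds hx] with y hy
    exact sum_coord_mul_grad3 hf hf0 hy
  have h := hev.grad3_eq i
  have hd : ∀ j, DifferentiableAt ℝ (fun y => grad3 f y j) x :=
    fun j => (contDiffOn_grad3 hf j).differentiableAt_of_ne hx
  have hm : ∀ j, DifferentiableAt ℝ (fun y : E3 => y j * grad3 f y j) x :=
    fun j => (differentiableAt_coord x j).fun_mul (hd j)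
  rw [grad3_add ((hm 0).fun_add (hm 1)) (hm 2), grad3_add (hm 0) (hm 1)] at h
  simp only [grad3_mul (differentiableAt_coord x _) (hd _), grad3_coord] at h
  have hz : grad3 (fun _ : E3 => (0 : ℝ)) x i = 0 := by simp [grad3]
  rw [hz] at h
  fin_cases i <;> simp at h ⊢ <;> linarith

theorem crossMat_trace (x : E3) (A B : Matrix (Fin 3) (Fin 3) ℝ) (a b : Fin 3 → ℝ)
    (hx : x 0 ^ 2 + x 1 ^ 2 + x 2 ^ 2 = 1) (hA : A.IsSymm) (hB : B.IsSymm)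
    (ha : x 0 * a 0 + x 1 * a 1 + x 2 * a 2 = 0) (hb : x 0 * b 0 + x 1 * b 1 + x 2 * b 2 = 0)
    (hAx : ∀ i, x 0 * A i 0 + x 1 * A i 1 + x 2 * A i 2 = -a i)
    (hBx : ∀ i, x 0 * B i 0 + x 1 * B i 1 + x 2 * B i 2 = -b i) :
    (crossMat x * (proj3 x * A * proj3 x) * (proj3 x * B * proj3 x)).trace =
      (crossMat x * A * B).trace - dot3 (fun i => x i) (cross3 a b) := by
  have hproj : ∀ (M : Matrix (Fin 3) (Fin 3) ℝ) (m : Fin 3 → ℝ), M.IsSymm →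
      x 0 * m 0 + x 1 * m 1 + x 2 * m 2 = 0 →
      (∀ i, x 0 * M i 0 + x 1 * M i 1 + x 2 * M i 2 = -m i) →
      proj3 x * M * proj3 x = Matrix.of fun i j => M i j + x i * m j + m i * x j := by
    intro M m hM hm hMx
    have hl : proj3 x * M = Matrix.of fun i j => M i j + x i * m j := by
      ext i j
      have h := hMx j
      rw [hM.apply 0 j, hM.apply 1 j, hM.apply 2 j] at h
      rw [proj3, sub_mul, one_mul]
      simp only [Matrix.sub_apply, Matrix.mul_apply, Matrix.of_apply,
        Fin.sum_univ_three]
      linear_combination -x i * h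
    rw [hl, proj3, mul_sub, mul_one]
    ext i j
    simp only [Matrix.sub_apply, Matrix.mul_apply, Matrix.of_apply,
      Fin.sum_univ_three]
    linear_combination -x j * hMx i - x i * x j * hm
  rw [hproj A a hA ha hAx, hproj B b hB hb hBx]
  have hB' : ∀ i, x 0 * B 0 i + x 1 * B 1 i + x 2 * B 2 i = -b i := fun i => by
    rw [← hBx i, ← hB.apply 0 i, ← hB.apply 1 i, ← hB.apply 2 i]
  simp only [Matrix.trace, Matrix.diag, Matrix.mul_apply, Fin.sum_univ_three, crossMat, dot3,
    cross3, Matrix.of_apply, Matrix.cons_val]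
  linear_combination
    (b 1 * x 2 - b 2 * x 1) * hAx 0 + (b 2 * x 0 - b 0 * x 2) * hAx 1 +
    (b 0 * x 1 - b 1 * x 0) * hAx 2 +
    (x 1 * a 2 - x 2 * a 1) * hB' 0 + (x 2 * a 0 - x 0 * a 2) * hB' 1 +
    (x 0 * a 1 - x 1 * a 0) * hB' 2 +
    (b 0 * (x 1 * a 2 - x 2 * a 1) + b 1 * (x 2 * a 0 - x 0 * a 2) +
      b 2 * (x 0 * a 1 - x 1 * a 0)) * hx

theorem cross3_eq_smul (x : E3) (a b : Fin 3 → ℝ) (hx : x 0 ^ 2 + x 1 ^ 2 + x 2 ^ 2 = 1)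
    (ha : x 0 * a 0 + x 1 * a 1 + x 2 * a 2 = 0) (hb : x 0 * b 0 + x 1 * b 1 + x 2 * b 2 = 0)
    (k : Fin 3) : cross3 a b k = x k * dot3 (fun i => x i) (cross3 a b) := by
  fin_cases k <;> simp [dot3, cross3, Fin.sum_univ_three]
  · linear_combination -(a 1 * b 2 - a 2 * b 1) * hx + (x 1 * b 2 - x 2 * b 1) * ha -
      (x 1 * a 2 - x 2 * a 1) * hb
  · linear_combination -(a 2 * b 0 - a 0 * b 2) * hx + (x 2 * b 0 - x 0 * b 2) * ha -
      (x 2 * a 0 - x 0 * a 2) * hb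
  · linear_combination -(a 0 * b 1 - a 1 * b 0) * hx + (x 0 * b 1 - x 1 * b 0) * ha -
      (x 0 * a 1 - x 1 * a 0) * hb

/-- The vector field whose curl yields the integration by parts: up to sign, it is
`x_k (D²u) ∇v + (x × ∇u)_k (x × ∇v) + x_k (Δv) ∇u`. -/
def potential (u v : E3 → ℝ) (k i : Fin 3) (x : E3) : ℝ :=
  x k * (grad3 (fun y => grad3 u y 0) x i * grad3 v x 0 +
      grad3 (fun y => grad3 u y 1) x i * grad3 v x 1 +
      grad3 (fun y => grad3 u y 2) x i * grad3 v x 2) +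
    rotDeriv k u x * rotDeriv i v x + x k * lap3 v x * grad3 u x i

theorem contDiffOn_coord (j : Fin 3) : ContDiffOn ℝ ∞ (fun y : E3 => y j) {(0 : E3)}ᶜ :=
  (EuclideanSpace.proj (𝕜 := ℝ) j).contDiff.contDiffOn

theorem contDiffOn_rotDeriv {f : E3 → ℝ} (hf : ContDiffOn ℝ ∞ f {(0 : E3)}ᶜ) (i : Fin 3) :
    ContDiffOn ℝ ∞ (rotDeriv i f) {(0 : E3)}ᶜ :=
  ((contDiffOn_coord _).mul (contDiffOn_grad3 hf _)).sub
    ((contDiffOn_coord _).mul (contDiffOn_grad3 hf _))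

theorem contDiffOn_lap3 {f : E3 → ℝ} (hf : ContDiffOn ℝ ∞ f {(0 : E3)}ᶜ) :
    ContDiffOn ℝ ∞ (lap3 f) {(0 : E3)}ᶜ :=
  ContDiffOn.congr (ContDiffOn.sum fun i _ => contDiffOn_grad3 (contDiffOn_grad3 hf i) i)
    fun _ hx => Finset.sum_congr rfl fun i _ => hess3_apply hf hx i i

theorem contDiffOn_potential {u v : E3 → ℝ} (hu : ContDiffOn ℝ ∞ u {(0 : E3)}ᶜ)
    (hv : ContDiffOn ℝ ∞ v {(0 : E3)}ᶜ) (k i : Fin 3) :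
    ContDiffOn ℝ ∞ (potential u v k i) {(0 : E3)}ᶜ := by
  have h := fun j => (contDiffOn_grad3 (contDiffOn_grad3 hu j) i).mul (contDiffOn_grad3 hv j)
  exact (((contDiffOn_coord k).mul (((h 0).add (h 1)).add (h 2))).add
    ((contDiffOn_rotDeriv hu k).mul (contDiffOn_rotDeriv hv i))).add
    (((contDiffOn_coord k).mul (contDiffOn_lap3 hv)).mul (contDiffOn_grad3 hu i))

theorem grad3_rotDeriv {f : E3 → ℝ} (hf : ContDiffOn ℝ ∞ f {(0 : E3)}ᶜ) {x : E3} (hx : x ≠ 0)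
    (i l : Fin 3) : grad3 (rotDeriv i f) x l =
      x (i + 1) * grad3 (fun y => grad3 f y (i + 2)) x l +
        (if i + 1 = l then 1 else 0) * grad3 f x (i + 2) -
      (x (i + 2) * grad3 (fun y => grad3 f y (i + 1)) x l +
        (if i + 2 = l then 1 else 0) * grad3 f x (i + 1)) := by
  have hd : ∀ j, DifferentiableAt ℝ (fun y => grad3 f y j) x :=
    fun j => (contDiffOn_grad3 hf j).differentiableAt_of_ne hx
  have hc := differentiableAt_coord x
  unfold rotDeriv
  rw [grad3_sub ((hc _).fun_mul (hd _)) ((hc _).fun_mul (hd _)), grad3_mul (hc _) (hd _),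
    grad3_mul (hc _) (hd _), grad3_coord, grad3_coord]

theorem grad3_potential {u v : E3 → ℝ} (hu : ContDiffOn ℝ ∞ u {(0 : E3)}ᶜ)
    (hv : ContDiffOn ℝ ∞ v {(0 : E3)}ᶜ) {x : E3} (hx : x ≠ 0) (k i l : Fin 3) :
    grad3 (potential u v k i) x l =
      x k * ∑ m, (grad3 (fun y => grad3 u y m) x i * grad3 (fun y => grad3 v y m) x l +
        grad3 (fun y => grad3 (fun z => grad3 u z m) y i) x l * grad3 v x m) +
      (if k = l then 1 else 0) * ∑ m, grad3 (fun y => grad3 u y m) x i * grad3 v x m +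
      (rotDeriv k u x * grad3 (rotDeriv i v) x l + grad3 (rotDeriv k u) x l * rotDeriv i v x) +
      (x k * lap3 v x * grad3 (fun y => grad3 u y i) x l +
        (x k * grad3 (lap3 v) x l + (if k = l then 1 else 0) * lap3 v x) * grad3 u x i) := by
  have hc := differentiableAt_coord x
  have hu1 := fun j => (contDiffOn_grad3 hu j).differentiableAt_of_ne hx
  have hv1 := fun j => (contDiffOn_grad3 hv j).differentiableAt_of_ne hx
  have hu2 := fun j => (contDiffOn_grad3 (contDiffOn_grad3 hu j) i).differentiableAt_of_ne hx
  have hru : DifferentiableAt ℝ (fun y => rotDeriv k u y) x :=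
    (contDiffOn_rotDeriv hu k).differentiableAt_of_ne hx
  have hrv : DifferentiableAt ℝ (fun y => rotDeriv i v y) x :=
    (contDiffOn_rotDeriv hv i).differentiableAt_of_ne hx
  have hl : DifferentiableAt ℝ (fun y => lap3 v y) x :=
    (contDiffOn_lap3 hv).differentiableAt_of_ne hx
  have hm := fun j => (hu2 j).fun_mul (hv1 j)
  have hs := ((hm 0).fun_add (hm 1)).fun_add (hm 2)
  have hcl := (hc k).fun_mul hl
  unfold potential
  rw [grad3_add (((hc k).fun_mul hs).fun_add (hru.fun_mul hrv)) (hcl.fun_mul (hu1 i)),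
    grad3_add ((hc k).fun_mul hs) (hru.fun_mul hrv), grad3_mul (hc k) hs,
    grad3_add ((hm 0).fun_add (hm 1)) (hm 2), grad3_add (hm 0) (hm 1),
    grad3_mul (hu2 0) (hv1 0), grad3_mul (hu2 1) (hv1 1), grad3_mul (hu2 2) (hv1 2),
    grad3_mul hru hrv, grad3_mul hcl (hu1 i), grad3_mul (hc k) hl, grad3_coord]
  simp only [Fin.sum_univ_three]

theorem rotDeriv_potential {u v : E3 → ℝ} (hu : ContDiffOn ℝ ∞ u {(0 : E3)}ᶜ)
    (hv : ContDiffOn ℝ ∞ v {(0 : E3)}ᶜ) (hu0 : Homog0 u) (hv0 : Homog0 v) {x : E3}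
    (hx : x ∈ Metric.sphere (0 : E3) 1) (k : Fin 3) :
    x k * (crossMat x * hessS u x * hessS v x).trace =
      -(x k * dot3 (fun i => x i)
          (cross3 (grad3 u x) (grad3 (fun y => lap3 v y + 2 * v y) x))) -
        ∑ i, rotDeriv i (potential u v k i) x := by
  have hne : x ≠ 0 := sphere_subset_compl hx
  have hx1 : x 0 ^ 2 + x 1 ^ 2 + x 2 ^ 2 = 1 := by
    have h := EuclideanSpace.real_norm_sq_eq x
    rw [mem_sphere_zero_iff_norm.1 hx, Fin.sum_univ_three] at h
    linarith
  have ha := sum_coord_mul_grad3 hu hu0 hne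
  have hb := sum_coord_mul_grad3 hv hv0 hne
  have hgrad : grad3 (fun y => lap3 v y + 2 * v y) x =
      fun i => grad3 (lap3 v) x i + 2 * grad3 v x i := by
    ext i
    have hd := hv.differentiableAt_of_ne hne
    rw [grad3_add (f := lap3 v) ((contDiffOn_lap3 hv).differentiableAt_of_ne hne)
      (hd.const_mul 2), grad3_mul (differentiableAt_const 2) hd]
    simp [grad3]
  have hsymm : ∀ f : E3 → ℝ, ContDiffOn ℝ ∞ f {(0 : E3)}ᶜ → (hess3 f x).IsSymm :=
    fun f hf => Matrix.IsSymm.ext fun i j => by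
      rw [hess3_apply hf hne, hess3_apply hf hne, grad3_comm hf hne]
  have htr := crossMat_trace x (hess3 u x) (hess3 v x) (grad3 u x) (grad3 v x) hx1
    (hsymm u hu) (hsymm v hv) ha hb
    (fun i => by simpa only [hess3_apply hu hne] using sum_coord_mul_grad3_grad3 hu hu0 hne i)
    (fun i => by simpa only [hess3_apply hv hne] using sum_coord_mul_grad3_grad3 hv hv0 hne i)
  have hcr := cross3_eq_smul x (grad3 u x) (grad3 v x) hx1 ha hb k
  have hlap : lap3 v x = grad3 (fun y => grad3 v y 0) x 0 + grad3 (fun y => grad3 v y 1) x 1 +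
      grad3 (fun y => grad3 v y 2) x 2 := by
    simp only [lap3, Fin.sum_univ_three, hess3_apply hv hne]
  have hu3 := fun m => grad3_comm (contDiffOn_grad3 hu m) hne
  unfold hessS
  rw [htr, hgrad]
  simp only [Fin.sum_univ_three, rotDeriv, grad3_potential hu hv hne]
  have hxx : (x 0 ^ 2 + x 1 ^ 2 + x 2 ^ 2 - 1) *
        (∑ l, grad3 (rotDeriv k u) x l * grad3 v x l + rotDeriv k u x * lap3 v x) -
      (x 0 * grad3 v x 0 + x 1 * grad3 v x 1 + x 2 * grad3 v x 2) *
        (∑ l, grad3 (rotDeriv k u) x l * x l + 2 * rotDeriv k u x) -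
      rotDeriv k u x * ∑ l, x l * (x 0 * grad3 (fun y => grad3 v y 0) x l +
        x 1 * grad3 (fun y => grad3 v y 1) x l + x 2 * grad3 (fun y => grad3 v y 2) x l) = 0 := by
    simp only [hx1, hb, sum_coord_mul_grad3_grad3 hv hv0 hne, Fin.sum_univ_three]
    linear_combination rotDeriv k u x * hb
  have hu2 := grad3_comm hu hne
  have hv2 := grad3_comm hv hne
  simp only [grad3_rotDeriv hu hne, grad3_rotDeriv hv hne, Matrix.trace, Matrix.diag,
    Matrix.mul_apply, Fin.sum_univ_three, crossMat, dot3, cross3, Matrix.of_apply,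
    Matrix.cons_val, hess3_apply hu hne, hess3_apply hv hne, hlap, rotDeriv] at hcr hxx ⊢
  fin_cases k <;> simp at hcr hxx ⊢ <;>
    simp only [hu2 1 0, hu2 2 0, hu2 2 1, hv2 1 0, hv2 2 0, hv2 2 1, fun m => hu3 m 1 0,
      fun m => hu3 m 2 0, fun m => hu3 m 2 1] at hxx ⊢ <;>
    linear_combination hxx - hcr

/-- for smooth degree-0 homogeneous u, v on ℝ³∖{0} and each k,
∫_{S²} x_k tr(J_x H_u H_v) dS = −∫_{S²} x_k ⟨x, ∇u × ∇(Δv + 2v)⟩ dS. -/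
theorem integral_hessian_contraction (u v : E3 → ℝ)
    (hu : ContDiffOn ℝ (⊤ : ℕ∞) u {(0:E3)}ᶜ) (hv : ContDiffOn ℝ (⊤ : ℕ∞) v {(0:E3)}ᶜ)
    (hu0 : Homog0 u) (hv0 : Homog0 v) (k : Fin 3) :
    ∫ x in Metric.sphere (0:E3) 1,
        x k * (crossMat x * hessS u x * hessS v x).trace ∂(μH[2]) =
    - ∫ x in Metric.sphere (0:E3) 1,
        x k * dot3 (fun i => x i)
          (cross3 (grad3 u x) (grad3 (fun y => lap3 v y + 2 * v y) x)) ∂(μH[2]) := by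
  have hrot := fun i => integrableOn_sphere
    (continuousOn_rotDeriv (contDiffOn_potential hu hv k i) i)
  have hint : IntegrableOn (fun x : E3 => x k * dot3 (fun i => x i)
      (cross3 (grad3 u x) (grad3 (fun y => lap3 v y + 2 * v y) x)))
      (Metric.sphere (0 : E3) 1) μH[2] := by
    have hu1 := fun j => (contDiffOn_grad3 hu j).continuousOn
    have hw1 := fun j =>
      (contDiffOn_grad3 ((contDiffOn_lap3 hv).add (contDiffOn_const.mul hv)) j
        (f := fun y => lap3 v y + 2 * v y)).continuousOn
    refine integrableOn_sphere ?_
    simp only [dot3, cross3, Fin.sum_univ_three, Matrix.cons_val]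
    fun_prop
  rw [setIntegral_congr_fun (isCompact_sphere _ _).measurableSet
      fun x hx => rotDeriv_potential hu hv hu0 hv0 hx k,
    integral_sub hint.fun_neg (integrable_finsetSum _ fun i _ => hrot i),
    integral_finsetSum _ fun i _ => hrot i, integral_neg]
  simp [integral_rotDeriv (contDiffOn_potential hu hv k _)]
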